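/- Let (E,j) be a soft inductive system of Banach spaces over a directed set N, let F be a Banach space, and let T_n : E_n → F be linear contractions such that for every j-convergent net x_• the net (T_n x_n)_{n∈N} is Cauchy in F. Then lim_n T_n x_n = 0 for every null net, and there is a linear contraction T_∞ : E_∞ → F satisfying T_∞(j-lim_n x_n) = lim_n T_n x_n for every j-convergent net x_•. -/

import Mathlib

open Filter Topology MeasureTheory

variable {N : Type*} [Preorder N] [IsDirected N (· ≤ ·)] [Nonempty N]
variable {E : N → Type*} [∀ n, NormedAddCommGroup (E n)] [∀ n, NormedSpace ℂ (E n)]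
  [∀ n, CompleteSpace (E n)]

/-- A *soft inductive system* of Banach spaces over the directed set `N`:
linear contractions `j n m : E m → E n` (for `n ≥ m`, with `j n n = id` and
`j n m = 0` when `¬ m ≤ n`), satisfying
`lim_m limsup_n ‖(j n l - j n m ∘ j m l) x‖ = 0` for all `l` and `x : E l`. -/
structure IsSoftInductiveSystem (j : ∀ n m : N, E m →L[ℂ] E n) : Prop where
  map_self : ∀ n, j n n = ContinuousLinearMap.id ℂ (E n)
  map_not_le : ∀ n m, ¬ m ≤ n → j n m = 0
  contraction : ∀ n m, m ≤ n → ∀ x : E m, ‖j n m x‖ ≤ ‖x‖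
  soft : ∀ (l : N) (x : E l),
    Tendsto (fun m => limsup (fun n => ‖j n l x - j n m (j m l x)‖) atTop)
      atTop (𝓝 0)

/-- A net `x = (x n)_{n ∈ N}` (with `x n ∈ E n`) is uniformly bounded. -/
def UniformlyBounded (x : ∀ n, E n) : Prop := ∃ C : ℝ, ∀ n, ‖x n‖ ≤ C

/-- The seminorm `|‖x‖| = limsup_n ‖x n‖` on uniformly bounded nets. -/
noncomputable def netSeminorm (x : ∀ n, E n) : ℝ := limsup (fun n => ‖x n‖) atTop

/-- The basic net `j_{• m} ξ` associated with `ξ ∈ E m`. -/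
def basicNet (j : ∀ n m : N, E m →L[ℂ] E n) (m : N) (ξ : E m) : ∀ n, E n :=
  fun n => j n m ξ

/-- A uniformly bounded net is `j`-convergent if it lies in the seminorm-closure of
the set of basic nets. -/
def JConvergent (j : ∀ n m : N, E m →L[ℂ] E n) (x : ∀ n, E n) : Prop :=
  UniformlyBounded x ∧
    ∀ ε : ℝ, 0 < ε → ∃ (m : N) (ξ : E m), netSeminorm (fun n => x n - j n m ξ) < ε

/-- A net is a null net if `lim_n ‖x n‖ = 0`. -/
def IsNullNet (x : ∀ n, E n) : Prop := Tendsto (fun n => ‖x n‖) atTop (𝓝 0)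

/-- A realization `(G, L)` of the limit space `E_∞ = C(E,j)/C₀(E,j)` of a soft inductive
system: `L` sends a `j`-convergent net to its `j`-limit; it is linear on `j`-convergent
nets, the norm of a `j`-limit is the seminorm of the net, and every element of `G`
arises as a `j`-limit. -/
structure IsLimitSpace (j : ∀ n m : N, E m →L[ℂ] E n) (G : Type*)
    [NormedAddCommGroup G] [NormedSpace ℂ G] (L : (∀ n, E n) → G) : Prop where
  map_add : ∀ x y, JConvergent j x → JConvergent j y → L (x + y) = L x + L y
  map_smul : ∀ (c : ℂ) (x), JConvergent j x → L (c • x) = c • L x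
  norm_eq : ∀ x, JConvergent j x → ‖L x‖ = netSeminorm x
  surjective : ∀ g : G, ∃ x, JConvergent j x ∧ L x = g

/-- The norms of a uniformly bounded net are eventually below any number exceeding its
seminorm. -/
lemma UniformlyBounded.eventually_norm_lt {x : ∀ n, E n} (hx : UniformlyBounded x) {ε : ℝ}
    (h : netSeminorm x < ε) : ∀ᶠ n in atTop, ‖x n‖ < ε := by
  obtain ⟨C, hC⟩ := hx
  exact eventually_lt_of_limsup_lt h (isBoundedUnder_of ⟨C, hC⟩)

lemma netSeminorm_le_of_eventually_norm_le {x : ∀ n, E n} {ε : ℝ}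
    (h : ∀ᶠ n in atTop, ‖x n‖ ≤ ε) : netSeminorm x ≤ ε :=
  limsup_le_of_le
    (isBoundedUnder_of ⟨0, fun n => norm_nonneg (x n)⟩ :
      IsBoundedUnder (· ≥ ·) atTop fun n => ‖x n‖).isCoboundedUnder_le h

lemma UniformlyBounded.add {x y : ∀ n, E n} (hx : UniformlyBounded x)
    (hy : UniformlyBounded y) : UniformlyBounded (x + y) := by
  obtain ⟨C, hC⟩ := hx
  obtain ⟨D, hD⟩ := hy
  exact ⟨C + D, fun n => norm_add_le_of_le (hC n) (hD n)⟩

lemma UniformlyBounded.smul {x : ∀ n, E n} (hx : UniformlyBounded x) (c : ℂ) :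
    UniformlyBounded (c • x) := by
  obtain ⟨C, hC⟩ := hx
  refine ⟨‖c‖ * C, fun n => ?_⟩
  rw [Pi.smul_apply, norm_smul]
  exact mul_le_mul_of_nonneg_left (hC n) (norm_nonneg c)

lemma UniformlyBounded.sub {x y : ∀ n, E n} (hx : UniformlyBounded x)
    (hy : UniformlyBounded y) : UniformlyBounded (fun n => x n - y n) := by
  obtain ⟨C, hC⟩ := hx
  obtain ⟨D, hD⟩ := hy
  exact ⟨C + D, fun n => norm_sub_le_of_le (hC n) (hD n)⟩

namespace IsSoftInductiveSystem

variable {j : ∀ n m : N, E m →L[ℂ] E n}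

lemma uniformlyBounded_basicNet (hj : IsSoftInductiveSystem j) (m : N) (ξ : E m) :
    UniformlyBounded (basicNet j m ξ) := by
  refine ⟨‖ξ‖, fun n => ?_⟩
  by_cases h : m ≤ n
  · exact hj.contraction n m h ξ
  · simp [basicNet, hj.map_not_le n m h]

/-- A basic net starting at `l` is close to the basic nets starting at its later entries. -/
lemma eventually_basicNet_close (hj : IsSoftInductiveSystem j) (l : N) (ξ : E l) {ε : ℝ}
    (hε : 0 < ε) :
    ∀ᶠ m in atTop, ∀ᶠ n in atTop, ‖j n l ξ - j n m (j m l ξ)‖ < ε := by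
  filter_upwards [(hj.soft l ξ).eventually_lt_const hε] with m hm
  exact UniformlyBounded.eventually_norm_lt
    ((hj.uniformlyBounded_basicNet l ξ).sub (hj.uniformlyBounded_basicNet m (j m l ξ))) hm

/-- Every `j`-convergent net is eventually close to a basic net. -/
lemma exists_eventually_close (hj : IsSoftInductiveSystem j) {x : ∀ n, E n}
    (hx : JConvergent j x) {ε : ℝ} (hε : 0 < ε) :
    ∃ (m : N) (ξ : E m), ∀ᶠ n in atTop, ‖x n - j n m ξ‖ < ε := by
  obtain ⟨m, ξ, h⟩ := hx.2 ε hε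
  exact ⟨m, ξ, UniformlyBounded.eventually_norm_lt
    (hx.1.sub (hj.uniformlyBounded_basicNet m ξ)) h⟩

lemma jConvergent_add (hj : IsSoftInductiveSystem j) {x y : ∀ n, E n}
    (hx : JConvergent j x) (hy : JConvergent j y) : JConvergent j (x + y) := by
  refine ⟨hx.1.add hy.1, fun ε hε => ?_⟩
  have hδ : 0 < ε / 5 := by positivity
  obtain ⟨l, ξ, hξ⟩ := hj.exists_eventually_close hx hδ
  obtain ⟨m, η, hη⟩ := hj.exists_eventually_close hy hδ
  obtain ⟨k, hkξ, hkη⟩ := ((hj.eventually_basicNet_close l ξ hδ).and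
    (hj.eventually_basicNet_close m η hδ)).exists
  refine ⟨k, j k l ξ + j k m η, ?_⟩
  refine (netSeminorm_le_of_eventually_norm_le (ε := 4 * (ε / 5)) ?_).trans_lt (by linarith)
  filter_upwards [hξ, hη, hkξ, hkη] with n h₁ h₂ h₃ h₄
  have hsplit : (x + y) n - j n k (j k l ξ + j k m η) =
      ((x n - j n l ξ) + (y n - j n m η)) +
        ((j n l ξ - j n k (j k l ξ)) + (j n m η - j n k (j k m η))) := by
    rw [_root_.map_add, Pi.add_apply]
    abel
  rw [hsplit]
  have := norm_add_le_of_le (norm_add_le_of_le h₁.le h₂.le) (norm_add_le_of_le h₃.le h₄.le)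
  linarith

lemma jConvergent_smul (hj : IsSoftInductiveSystem j) (c : ℂ) {x : ∀ n, E n}
    (hx : JConvergent j x) : JConvergent j (c • x) := by
  refine ⟨hx.1.smul c, fun ε hε => ?_⟩
  have hc : 0 < ‖c‖ + 1 := by positivity
  obtain ⟨m, ξ, hξ⟩ := hj.exists_eventually_close hx (ε := ε / 2 / (‖c‖ + 1)) (by positivity)
  refine ⟨m, c • ξ, ?_⟩
  refine (netSeminorm_le_of_eventually_norm_le (ε := ε / 2) ?_).trans_lt (by linarith)
  filter_upwards [hξ] with n hn
  rw [_root_.map_smul, Pi.smul_apply, ← smul_sub, norm_smul]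
  rw [lt_div_iff₀ hc] at hn
  nlinarith [norm_nonneg (x n - j n m ξ)]

end IsSoftInductiveSystem

/-- The limit of the images of a bounded net under contractions is bounded by the seminorm. -/
lemma UniformlyBounded.norm_le_netSeminorm_of_tendsto {F : Type*} [NormedAddCommGroup F]
    [NormedSpace ℂ F] {T : ∀ n, E n →L[ℂ] F} (hT : ∀ n (ξ : E n), ‖T n ξ‖ ≤ ‖ξ‖)
    {x : ∀ n, E n} (hx : UniformlyBounded x) {a : F}
    (ha : Tendsto (fun n => T n (x n)) atTop (𝓝 a)) : ‖a‖ ≤ netSeminorm x := by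
  refine le_of_forall_pos_le_add fun ε hε => le_of_tendsto ha.norm ?_
  filter_upwards [hx.eventually_norm_lt (lt_add_of_pos_right _ hε)] with n hn
  exact (hT n (x n)).trans hn.le

/-- (Universal property of the limit space.) If `T n : E n → F` are
linear contractions into a Banach space `F` mapping every `j`-convergent net to a
Cauchy net in `F`, then `lim_n T n (x n) = 0` for every (uniformly bounded) null net,
and there is a linear contraction `T_∞ : E_∞ → F` with
`T_∞ (j-lim x) = lim_n T n (x n)` for every `j`-convergent net. -/
theorem universal_property_of_limit (j : ∀ n m : N, E m →L[ℂ] E n)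
    (hj : IsSoftInductiveSystem j)
    {F : Type*} [NormedAddCommGroup F] [NormedSpace ℂ F] [CompleteSpace F]
    (T : ∀ n, E n →L[ℂ] F) (hT : ∀ n (ξ : E n), ‖T n ξ‖ ≤ ‖ξ‖)
    (hCauchy : ∀ x : ∀ n, E n, JConvergent j x →
      Cauchy (Filter.map (fun n => T n (x n)) atTop))
    {G : Type*} [NormedAddCommGroup G] [NormedSpace ℂ G] [CompleteSpace G]
    (L : (∀ n, E n) → G) (hL : IsLimitSpace j G L) :
    (∀ x : ∀ n, E n, UniformlyBounded x → IsNullNet x →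
      Tendsto (fun n => T n (x n)) atTop (𝓝 0)) ∧
    ∃ Tinf : G →L[ℂ] F, (∀ g : G, ‖Tinf g‖ ≤ ‖g‖) ∧
      ∀ x : ∀ n, E n, JConvergent j x →
        Tendsto (fun n => T n (x n)) atTop (𝓝 (Tinf (L x))) := by
  refine ⟨fun x _ hx => squeeze_zero_norm (fun n => hT n (x n)) hx, ?_⟩
  have hbound : ∀ x, JConvergent j x → ∀ a, Tendsto (fun n => T n (x n)) atTop (𝓝 a) →
      ‖a‖ ≤ ‖L x‖ := fun x hx a ha =>
    (hx.1.norm_le_netSeminorm_of_tendsto hT ha).trans_eq (hL.norm_eq x hx).symm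
  have hunique : ∀ x y, JConvergent j x → JConvergent j y → L x = L y → ∀ a b,
      Tendsto (fun n => T n (x n)) atTop (𝓝 a) →
      Tendsto (fun n => T n (y n)) atTop (𝓝 b) → a = b := by
    intro x y hx hy hxy a b ha hb
    have hy' := hj.jConvergent_smul (-1) hy
    have hlim : Tendsto (fun n => T n ((x + (-1 : ℂ) • y) n)) atTop (𝓝 (a - b)) := by
      simpa [sub_eq_add_neg] using ha.sub hb
    have hle := hbound _ (hj.jConvergent_add hx hy') _ hlim
    rw [hL.map_add _ _ hx hy', hL.map_smul _ _ hy, hxy, neg_one_smul, add_neg_cancel,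
      norm_zero] at hle
    exact sub_eq_zero.mp (norm_le_zero_iff.mp hle)
  choose s hs hLs using hL.surjective
  choose t ht using fun g => CompleteSpace.complete (hCauchy (s g) (hs g))
  have hlim : ∀ g, Tendsto (fun n => T n (s g n)) atTop (𝓝 (t g)) := ht
  let Tlin : G →ₗ[ℂ] F :=
    { toFun := t
      map_add' := fun g h => by
        refine hunique _ (s g + s h) (hs _) (hj.jConvergent_add (hs g) (hs h)) ?_ _ _ (hlim _) ?_
        · rw [hL.map_add _ _ (hs g) (hs h), hLs, hLs, hLs]
        · simpa using (hlim g).add (hlim h)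
      map_smul' := fun c g => by
        refine hunique _ (c • s g) (hs _) (hj.jConvergent_smul c (hs g)) ?_ _ _ (hlim _) ?_
        · rw [hL.map_smul _ _ (hs g), hLs, hLs]
        · simpa using (hlim g).const_smul c }
  have hcontr : ∀ g, ‖Tlin g‖ ≤ ‖g‖ := fun g =>
    (hbound _ (hs g) _ (hlim g)).trans_eq (congrArg _ (hLs g))
  refine ⟨Tlin.mkContinuous 1 fun g => by simpa using hcontr g, hcontr, fun x hx => ?_⟩
  obtain ⟨a, ha⟩ := CompleteSpace.complete (hCauchy x hx)
  obtain rfl : a = t (L x) := hunique x _ hx (hs _) (hLs _).symm _ _ ha (hlim _)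
  exact ha
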